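/- arXiv:1805.01507 — 4 statements merged into one kernel-verified Lean document; each statement's English description precedes it below -/
import Mathlib

section
/- Let (M,d) be a metric space, (μ_ε)_{ε>0} a family of Borel probability measures on M, and S : M → [0,∞] a lower semicontinuous function. Assume the LDP upper bound holds: for every closed set F ⊆ M, limsup_{ε→0} ε · log μ_ε(F) ≤ −inf_{x∈F} S(x). Then for every continuous function φ : M → [0,C] and every continuous function ψ : M → ℝ bounded above by C, one has limsup_{ε→0} ε · log ∫_M φ(x) · exp(ψ(x)/ε) dμ_ε(x) ≤ sup_{x ∈ supp(φ)} (ψ(x) − S(x)) (the right-hand side interpreted as −∞ if supp(φ) is empty). -/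
open MeasureTheory Filter Topology
open scoped ENNReal NNReal

theorem aux_log_le {ε c : ℝ} (hε : 0 < ε) (m : ENNReal) :
    (ε : EReal) * ENNReal.log m ≤ (c : EReal) ↔ m ≤ ENNReal.ofReal (Real.exp (c / ε)) := by
  rw [← ENNReal.log_le_log_iff, ENNReal.log_ofReal_of_pos (Real.exp_pos _), Real.log_exp,
    EReal.coe_div, EReal.le_div_iff_mul_le (by exact_mod_cast hε) (EReal.coe_ne_top _), mul_comm]

/-- Upper-bound half of the Laplace-type asymptotics (formula (actf) of the paper):
if the family of probability measures `μ ε` satisfies the large-deviations upper bound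
with lower semicontinuous rate function `S`, then for continuous `φ : M → [0,C]` and
continuous `ψ ≤ C`,
`limsup_{ε→0} ε log ∫ φ e^{ψ/ε} dμ_ε ≤ sup_{x ∈ supp φ} (ψ(x) − S(x))`. -/
theorem laplace_upper_bound
    {M : Type*} [MetricSpace M] [MeasurableSpace M] [BorelSpace M]
    (μ : ℝ → Measure M) (hprob : ∀ ε : ℝ, 0 < ε → IsProbabilityMeasure (μ ε))
    (S : M → ℝ≥0∞) (hS : LowerSemicontinuous S)
    (hLDPupper : ∀ F : Set M, IsClosed F →
      Filter.limsup (fun ε : ℝ => (ε : EReal) * ENNReal.log (μ ε F)) (𝓝[>] (0 : ℝ))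
        ≤ - ⨅ x ∈ F, (S x : EReal))
    (C : ℝ) (hC : 0 < C)
    (φ : M → ℝ) (hφcont : Continuous φ) (hφrange : ∀ x, φ x ∈ Set.Icc (0 : ℝ) C)
    (ψ : M → ℝ) (hψcont : Continuous ψ) (hψle : ∀ x, ψ x ≤ C) :
    Filter.limsup
      (fun ε : ℝ => (ε : EReal) *
        ENNReal.log (∫⁻ x, ENNReal.ofReal (φ x * Real.exp (ψ x / ε)) ∂(μ ε)))
      (𝓝[>] (0 : ℝ))
      ≤ ⨆ x ∈ tsupport φ, ((ψ x : EReal) - (S x : EReal)) := by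
  have key : ∀ a δ : ℝ, 0 < δ → (⨆ x ∈ tsupport φ, ((ψ x : EReal) - (S x : EReal))) < (a : EReal) →
      Filter.limsup
      (fun ε : ℝ => (ε : EReal) *
        ENNReal.log (∫⁻ x, ENNReal.ofReal (φ x * Real.exp (ψ x / ε)) ∂(μ ε)))
      (𝓝[>] (0 : ℝ)) ≤ ((a + 3 * δ : ℝ) : EReal) := by
    intro a δ hδ ha
    obtain ⟨N, hN⟩ : ∃ N : ℕ, N = ⌊(C - a) / δ⌋₊ + 1 := ⟨_, rfl⟩
    let F : ℕ → Set M := fun k => tsupport φ ∩ ψ ⁻¹' Set.Icc (a + k * δ) (a + (k + 1) * δ)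
    have hF : ∀ k, IsClosed (F k) := fun k =>
      (isClosed_tsupport φ).inter (isClosed_Icc.preimage hψcont)
    have hinf : ∀ k : ℕ, ((k * δ : ℝ) : EReal) ≤ ⨅ x ∈ F k, (S x : EReal) := by
      intro k
      refine le_iInf₂ fun x hx => ?_
      have h1 : (ψ x : EReal) - (S x : EReal) < (a : EReal) :=
        lt_of_le_of_lt (le_iSup₂ (f := fun x (_ : x ∈ tsupport φ) =>
          (ψ x : EReal) - (S x : EReal)) x hx.1) ha
      have h2 := hx.2.1
      by_cases hT : S x = ⊤
      · rw [hT]; simp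
      · lift S x to ℝ≥0 using hT with s hs
        have h3 : ((s : ℝ≥0∞) : EReal) = ((s : ℝ) : EReal) := rfl
        rw [h3] at h1 ⊢
        rw [← EReal.coe_sub, EReal.coe_lt_coe_iff] at h1
        rw [EReal.coe_le_coe_iff]
        linarith
    have hev : ∀ k : ℕ, ∀ᶠ ε in 𝓝[>] (0 : ℝ),
        μ ε (F k) ≤ ENNReal.ofReal (Real.exp ((δ - k * δ) / ε)) := by
      intro k
      have h1 : Filter.limsup (fun ε : ℝ => (ε : EReal) * ENNReal.log (μ ε (F k))) (𝓝[>] (0 : ℝ))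
          < ((δ - k * δ : ℝ) : EReal) := by
        refine lt_of_le_of_lt ((hLDPupper _ (hF k)).trans (EReal.neg_le_neg_iff.2 (hinf k))) ?_
        rw [← EReal.coe_neg, EReal.coe_lt_coe_iff]
        linarith
      filter_upwards [eventually_lt_of_limsup_lt h1, self_mem_nhdsWithin] with ε h2 hε
      exact (aux_log_le hε _).1 h2.le
    have hall : ∀ᶠ ε in 𝓝[>] (0 : ℝ), ∀ k ∈ Finset.range N,
        μ ε (F k) ≤ ENNReal.ofReal (Real.exp ((δ - k * δ) / ε)) :=
      (Filter.eventually_all_finset _).2 fun k _ => hev k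
    have hK : 0 < C * (N + 1) := by positivity
    have hlim : ∀ᶠ ε in 𝓝[>] (0 : ℝ), ε * Real.log (C * (N + 1)) < δ := by
      have : Tendsto (fun ε : ℝ => ε * Real.log (C * (N + 1))) (𝓝[>] 0) (𝓝 0) := by
        have h : Continuous (fun ε : ℝ => ε * Real.log (C * (N + 1))) := by fun_prop
        have := h.tendsto 0
        rw [zero_mul] at this
        exact this.mono_left nhdsWithin_le_nhds
      exact this.eventually_lt_const hδ
    refine Filter.limsup_le_of_le (h := ?_)
    filter_upwards [hall, hlim, self_mem_nhdsWithin] with ε h1 h2 hε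
    have hε : 0 < ε := hε
    haveI := hprob ε hε
    rw [aux_log_le hε]
    have hpt : ∀ x, ENNReal.ofReal (φ x * Real.exp (ψ x / ε)) ≤
        ENNReal.ofReal (C * Real.exp (a / ε)) + ∑ k ∈ Finset.range N,
          (F k).indicator (fun _ => ENNReal.ofReal (C * Real.exp ((a + (k + 1) * δ) / ε))) x := by
      intro x
      obtain ⟨h0, hc⟩ := hφrange x
      by_cases hx0 : φ x = 0
      · simp [hx0]
      by_cases hxa : ψ x ≤ a
      · refine le_trans (ENNReal.ofReal_le_ofReal ?_) le_self_add
        gcongr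
      push Not at hxa
      refine le_trans ?_ le_add_self
      have hq : 0 ≤ (ψ x - a) / δ := div_nonneg (by linarith) hδ.le
      obtain ⟨k, hk⟩ : ∃ k : ℕ, k = ⌊(ψ x - a) / δ⌋₊ := ⟨_, rfl⟩
      have hk1 : (k : ℝ) * δ ≤ ψ x - a := by
        rw [← le_div_iff₀ hδ, hk]; exact Nat.floor_le hq
      have hk2 : ψ x - a ≤ ((k : ℝ) + 1) * δ := by
        rw [← div_le_iff₀ hδ, hk]; exact (Nat.lt_floor_add_one _).le
      have hkN : k ∈ Finset.range N := by
        rw [Finset.mem_range, hN, hk, Nat.lt_succ_iff]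
        apply Nat.floor_le_floor
        have := hψle x
        gcongr
      have hxF : x ∈ F k := ⟨subset_tsupport φ hx0, by linarith, by linarith⟩
      refine le_trans ?_ (Finset.single_le_sum (f := fun k : ℕ => (F k).indicator
        (fun _ => ENNReal.ofReal (C * Real.exp ((a + (k + 1) * δ) / ε))) x)
        (fun _ _ => zero_le) hkN)
      simp only [Set.indicator_of_mem hxF]
      apply ENNReal.ofReal_le_ofReal
      have : ψ x ≤ a + (k + 1) * δ := by linarith
      gcongr
    calc ∫⁻ x, ENNReal.ofReal (φ x * Real.exp (ψ x / ε)) ∂(μ ε)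
        ≤ ∫⁻ x, (ENNReal.ofReal (C * Real.exp (a / ε)) + ∑ k ∈ Finset.range N,
          (F k).indicator (fun _ => ENNReal.ofReal (C * Real.exp ((a + (k + 1) * δ) / ε))) x)
            ∂(μ ε) := lintegral_mono hpt
      _ = ENNReal.ofReal (C * Real.exp (a / ε)) + ∑ k ∈ Finset.range N,
          ENNReal.ofReal (C * Real.exp ((a + (k + 1) * δ) / ε)) * μ ε (F k) := by
        rw [lintegral_add_left measurable_const, lintegral_finsetSum]
        · simp only [lintegral_indicator_const (hF _).measurableSet]
          simp
        · exact fun k _ => measurable_const.indicator (hF k).measurableSet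
      _ ≤ ENNReal.ofReal (C * Real.exp ((a + 2 * δ) / ε)) + ∑ k ∈ Finset.range N,
          ENNReal.ofReal (C * Real.exp ((a + 2 * δ) / ε)) := by
        gcongr with k hk
        · linarith
        · refine (mul_le_mul_right (h1 k hk) _).trans ?_
          rw [← ENNReal.ofReal_mul (by positivity), mul_assoc, ← Real.exp_add]
          apply le_of_eq
          congr 3
          field_simp
          ring
      _ = ENNReal.ofReal (C * (N + 1) * Real.exp ((a + 2 * δ) / ε)) := by
        rw [Finset.sum_const, Finset.card_range, nsmul_eq_mul, ← ENNReal.ofReal_natCast,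
          ← ENNReal.ofReal_mul (by positivity), ← ENNReal.ofReal_add (by positivity) (by positivity)]
        congr 1
        ring
      _ ≤ ENNReal.ofReal (Real.exp ((a + 3 * δ) / ε)) := by
        apply ENNReal.ofReal_le_ofReal
        rw [← Real.exp_log hK, ← Real.exp_add, Real.exp_le_exp, le_div_iff₀ hε, add_mul,
          div_mul_cancel₀ _ hε.ne']
        linarith
  refine EReal.le_of_forall_lt_iff_le.1 fun b hb => ?_
  obtain ⟨a, ha1, ha2⟩ := EReal.lt_iff_exists_real_btwn.1 hb
  rw [EReal.coe_lt_coe_iff] at ha2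
  have := key a ((b - a) / 3) (by linarith) ha1
  rwa [show a + 3 * ((b - a) / 3) = b by ring] at this
end

section
/- Let (M,d) be a metric space, (μ_ε)_{ε>0} a family of Borel probability measures on M, and S : M → [0,∞] a lower semicontinuous function. Assume both the LDP upper bound (for every closed F ⊆ M, limsup_{ε→0} ε · log μ_ε(F) ≤ −inf_F S) and the LDP lower bound (for every open U ⊆ M, liminf_{ε→0} ε · log μ_ε(U) ≥ −inf_U S). Let φ : M → [0,C] and ψ : M → ℝ be continuous with ψ ≤ C, let {x : φ(x) > 0} be nonempty, and assume sup_{x ∈ supp(φ)} (ψ(x) − S(x)) = sup_{x : φ(x) > 0} (ψ(x) − S(x)) =: V. Then lim_{ε→0} ε · log ∫_M φ(x) · exp(ψ(x)/ε) dμ_ε(x) = V (as a limit in [−∞, ∞)). -/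
open MeasureTheory Filter Topology
open scoped ENNReal NNReal

lemma aux_mul_mono {ε : ℝ} (hε : 0 < ε) : StrictMono fun a : EReal => (ε : EReal) * a := by
  have h0 : (0 : EReal) < ε := EReal.coe_pos.2 hε
  intro a b hab
  show (ε : EReal) * a < ε * b
  rw [mul_comm, ← EReal.lt_div_iff h0 (EReal.coe_ne_top ε), ← EReal.mul_div,
    EReal.mul_div_cancel (EReal.coe_ne_bot ε) (EReal.coe_ne_top ε) h0.ne']
  exact hab

lemma aux_log_lt {ε : ℝ} (hε : 0 < ε) (m : ℝ≥0∞) (r : ℝ) :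
    (ε : EReal) * ENNReal.log m < r ↔ m < ENNReal.ofReal (Real.exp (r / ε)) := by
  have h1 : (r : EReal) = (ε : EReal) * ENNReal.log (ENNReal.ofReal (Real.exp (r / ε))) := by
    rw [ENNReal.log_ofReal_of_pos (Real.exp_pos _), Real.log_exp, ← EReal.coe_mul]
    congr 1
    field_simp
  rw [h1, ← ENNReal.log_lt_log_iff (x := m)]
  exact (aux_mul_mono hε).lt_iff_lt

lemma aux_lt_log {ε : ℝ} (hε : 0 < ε) (m : ℝ≥0∞) (r : ℝ) :
    (r : EReal) < (ε : EReal) * ENNReal.log m ↔ ENNReal.ofReal (Real.exp (r / ε)) < m := by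
  have h1 : (r : EReal) = (ε : EReal) * ENNReal.log (ENNReal.ofReal (Real.exp (r / ε))) := by
    rw [ENNReal.log_ofReal_of_pos (Real.exp_pos _), Real.log_exp, ← EReal.coe_mul]
    congr 1
    field_simp
  rw [h1, ← ENNReal.log_lt_log_iff (y := m)]
  exact (aux_mul_mono hε).lt_iff_lt

lemma aux_ev (D : ℝ) {δ : ℝ} (hδ : 0 < δ) :
    ∀ᶠ ε : ℝ in 𝓝[>] (0 : ℝ), D < Real.exp (δ / ε) := by
  have h : Tendsto (fun ε : ℝ => Real.exp (δ / ε)) (𝓝[>] (0 : ℝ)) atTop := by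
    simp only [div_eq_mul_inv]
    exact Real.tendsto_exp_atTop.comp (tendsto_inv_nhdsGT_zero.const_mul_atTop hδ)
  exact h.eventually_gt_atTop D

/-- Laplace-type equality (formula (actf) of the paper): if the family of probability
measures `μ ε` satisfies the full large deviation principle with lower semicontinuous
rate function `S`, `φ : M → [0,C]` and `ψ ≤ C` are continuous, `{φ > 0}` is nonempty,
and the sup of `ψ − S` over `supp φ` coincides with its sup over `{φ > 0}` (call it `V`),
then `ε log ∫ φ e^{ψ/ε} dμ_ε → V` as `ε → 0` (a limit in `[−∞, ∞)`, taken in `EReal`). -/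
theorem laplace_asymptotics
    {M : Type*} [MetricSpace M] [MeasurableSpace M] [BorelSpace M]
    (μ : ℝ → Measure M) (hprob : ∀ ε : ℝ, 0 < ε → IsProbabilityMeasure (μ ε))
    (S : M → ℝ≥0∞) (hS : LowerSemicontinuous S)
    (hLDPupper : ∀ F : Set M, IsClosed F →
      Filter.limsup (fun ε : ℝ => (ε : EReal) * ENNReal.log (μ ε F)) (𝓝[>] (0 : ℝ))
        ≤ - ⨅ x ∈ F, (S x : EReal))
    (hLDPlower : ∀ U : Set M, IsOpen U →
      (- ⨅ x ∈ U, (S x : EReal)) ≤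
        Filter.liminf (fun ε : ℝ => (ε : EReal) * ENNReal.log (μ ε U)) (𝓝[>] (0 : ℝ)))
    (C : ℝ) (hC : 0 < C)
    (φ : M → ℝ) (hφcont : Continuous φ) (hφrange : ∀ x, φ x ∈ Set.Icc (0 : ℝ) C)
    (ψ : M → ℝ) (hψcont : Continuous ψ) (hψle : ∀ x, ψ x ≤ C)
    (hne : {x : M | 0 < φ x}.Nonempty)
    (V : EReal)
    (hV₁ : V = ⨆ x ∈ tsupport φ, ((ψ x : EReal) - (S x : EReal)))
    (hV₂ : V = ⨆ x ∈ {x : M | 0 < φ x}, ((ψ x : EReal) - (S x : EReal))) :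
    Filter.Tendsto
      (fun ε : ℝ => (ε : EReal) *
        ENNReal.log (∫⁻ x, ENNReal.ofReal (φ x * Real.exp (ψ x / ε)) ∂(μ ε)))
      (𝓝[>] (0 : ℝ)) (𝓝 V) := by
  refine tendsto_order.2 ⟨fun a ha => ?_, fun b hb => ?_⟩
  · obtain ⟨r, har, hr⟩ := EReal.lt_iff_exists_real_btwn.1 ha
    rw [hV₂] at hr
    simp only [lt_iSup_iff] at hr
    obtain ⟨x, hx, hxr⟩ := hr
    have hx : 0 < φ x := hx
    have hSx : S x ≠ ⊤ := by
      intro h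
      rw [h] at hxr
      simp at hxr
    obtain ⟨s, hs⟩ : ∃ s : ℝ, (S x : EReal) = (s : EReal) :=
      ⟨(S x).toReal, by rw [EReal.coe_ennreal_toReal hSx]⟩
    rw [hs, ← EReal.coe_sub, EReal.coe_lt_coe_iff] at hxr
    obtain ⟨δ, hδ⟩ : ∃ δ, δ = (ψ x - s - r) / 4 := ⟨_, rfl⟩
    have hδ0 : 0 < δ := by rw [hδ]; linarith
    let U : Set M := {y | φ x / 2 < φ y} ∩ {y | ψ x - δ < ψ y}
    have hU : IsOpen U :=
      (isOpen_lt continuous_const hφcont).inter (isOpen_lt continuous_const hψcont)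
    have hxU : x ∈ U := ⟨by show φ x / 2 < φ x; linarith, by show ψ x - δ < ψ x; linarith⟩
    have h1 : ((-s - δ : ℝ) : EReal) < - ⨅ x ∈ U, (S x : EReal) := by
      have h2 : (⨅ x ∈ U, (S x : EReal)) ≤ (s : EReal) := hs ▸ iInf₂_le x hxU
      refine lt_of_lt_of_le ?_ (EReal.neg_le_neg_iff.2 h2)
      rw [← EReal.coe_neg, EReal.coe_lt_coe_iff]
      linarith
    have h2 := eventually_lt_of_lt_liminf (h1.trans_le (hLDPlower U hU))
    filter_upwards [h2, aux_ev (2 / φ x) hδ0, self_mem_nhdsWithin] with ε h2 h3 hε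
    have hε : 0 < ε := hε
    refine har.trans ((aux_lt_log hε _ _).2 ?_)
    rw [aux_lt_log hε] at h2
    have h4 : ENNReal.ofReal (φ x / 2 * Real.exp ((ψ x - δ) / ε)) * μ ε U ≤
        ∫⁻ y, ENNReal.ofReal (φ y * Real.exp (ψ y / ε)) ∂(μ ε) := by
      rw [← lintegral_indicator_const hU.measurableSet]
      refine lintegral_mono fun y => ?_
      by_cases hy : y ∈ U
      · rw [Set.indicator_of_mem hy]
        apply ENNReal.ofReal_le_ofReal
        have hy1 : φ x / 2 < φ y := hy.1
        have hy2 : ψ x - δ < ψ y := hy.2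
        have : (0:ℝ) ≤ φ y := (hφrange y).1
        gcongr
      · rw [Set.indicator_of_notMem hy]
        exact zero_le
    refine lt_of_lt_of_le ?_ ((mul_le_mul_right h2.le _).trans h4)
    rw [← ENNReal.ofReal_mul (by positivity)]
    refine (ENNReal.ofReal_lt_ofReal_iff (by positivity)).2 ?_
    have h5 : 1 < φ x / 2 * Real.exp (δ / ε) := by
      rw [div_lt_iff₀ hx] at h3
      linarith
    have h6 : Real.exp ((ψ x - δ) / ε) * Real.exp ((-s - δ) / ε)
        = Real.exp (δ / ε) * Real.exp ((r + δ) / ε) := by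
      rw [← Real.exp_add, ← Real.exp_add]
      congr 1
      rw [← add_div, ← add_div]
      congr 1
      rw [hδ]; ring
    have h7 : Real.exp (r / ε) < Real.exp ((r + δ) / ε) := by
      apply Real.exp_lt_exp.2
      gcongr
      linarith
    rw [mul_assoc, h6, ← mul_assoc]
    nlinarith [Real.exp_pos ((r + δ) / ε)]
  · obtain ⟨b1, hVb1, hb1⟩ := EReal.lt_iff_exists_real_btwn.1 hb
    obtain ⟨b0, hVb0, hb01⟩ := EReal.lt_iff_exists_real_btwn.1 hVb1
    rw [EReal.coe_lt_coe_iff] at hb01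
    obtain ⟨δ, hδ⟩ : ∃ δ, δ = (b1 - b0) / 3 := ⟨_, rfl⟩
    have hδ0 : 0 < δ := by rw [hδ]; linarith
    obtain ⟨N, hN⟩ := exists_nat_gt ((C - b0) / δ)
    rw [div_lt_iff₀ hδ0] at hN
    let F : ℕ → Set M := fun j => tsupport φ ∩ ({y | b0 + j * δ ≤ ψ y} ∩ {y | ψ y ≤ b0 + (j + 1) * δ})
    have hF : ∀ j, IsClosed (F j) := fun j =>
      (isClosed_tsupport φ).inter
        ((isClosed_le continuous_const hψcont).inter (isClosed_le hψcont continuous_const))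
    have h1 : ∀ j : ℕ, ∀ᶠ ε : ℝ in 𝓝[>] (0 : ℝ),
        (ε : EReal) * ENNReal.log (μ ε (F j)) < ((-(j * δ) + δ : ℝ) : EReal) := by
      intro j
      refine eventually_lt_of_limsup_lt (lt_of_le_of_lt (hLDPupper _ (hF j)) ?_)
      have h2 : ((j * δ : ℝ) : EReal) ≤ ⨅ x ∈ F j, (S x : EReal) := by
        refine le_iInf₂ fun x hx => ?_
        have hx1 : (ψ x : EReal) - (S x : EReal) < b0 := by
          refine lt_of_le_of_lt ?_ hVb0
          rw [hV₁]
          exact le_iSup₂ (f := fun x (_ : x ∈ tsupport φ) => (ψ x : EReal) - (S x : EReal)) x hx.1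
        have hx2 : b0 + j * δ ≤ ψ x := hx.2.1
        by_cases hSx : S x = ⊤
        · simp [hSx]
        · rw [← EReal.coe_ennreal_toReal hSx] at hx1 ⊢
          rw [← EReal.coe_sub, EReal.coe_lt_coe_iff] at hx1
          rw [EReal.coe_le_coe_iff]
          linarith
      refine lt_of_le_of_lt (EReal.neg_le_neg_iff.2 h2) ?_
      rw [← EReal.coe_neg, EReal.coe_lt_coe_iff]
      linarith
    have h2 := (Finset.eventually_all (Finset.range N)).2 fun j _ => h1 j
    filter_upwards [h2, aux_ev (C * (N + 1)) hδ0, self_mem_nhdsWithin] with ε h2 h3 hε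
    have hε : 0 < ε := hε
    have := hprob ε hε
    refine lt_trans ((aux_log_lt hε _ _).2 ?_) hb1
    have hpt : ∀ y, ENNReal.ofReal (φ y * Real.exp (ψ y / ε)) ≤
        ENNReal.ofReal (C * Real.exp (b0 / ε)) + ∑ j ∈ Finset.range N,
          (F j).indicator (fun _ => ENNReal.ofReal (C * Real.exp ((b0 + (j + 1) * δ) / ε))) y := by
      intro y
      have hy0 := (hφrange y).1
      have hyC := (hφrange y).2
      by_cases hy : ψ y ≤ b0
      · refine le_trans (ENNReal.ofReal_le_ofReal ?_) le_self_add
        gcongr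
      by_cases hφy : φ y = 0
      · simp [hφy]
      push Not at hy
      have hyj0 : 0 ≤ (ψ y - b0) / δ := div_nonneg (by linarith) hδ0.le
      obtain ⟨j, hj⟩ : ∃ j, j = ⌊(ψ y - b0) / δ⌋₊ := ⟨_, rfl⟩
      have hj1 : (j : ℝ) ≤ (ψ y - b0) / δ := hj ▸ Nat.floor_le hyj0
      have hj2 : (ψ y - b0) / δ < j + 1 := hj ▸ Nat.lt_floor_add_one _
      rw [le_div_iff₀ hδ0] at hj1
      rw [div_lt_iff₀ hδ0] at hj2
      have hjN : j < N := by
        have h : (j : ℝ) * δ < N * δ := by linarith [hψle y]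
        exact_mod_cast lt_of_mul_lt_mul_right h hδ0.le
      have hyF : y ∈ F j := by
        refine ⟨subset_tsupport φ hφy, ?_, ?_⟩
        · show b0 + j * δ ≤ ψ y
          linarith
        · show ψ y ≤ b0 + (j + 1) * δ
          linarith
      refine le_trans ?_ le_add_self
      refine le_trans ?_ (Finset.single_le_sum (fun _ _ => zero_le) (Finset.mem_range.2 hjN))
      rw [Set.indicator_of_mem hyF]
      apply ENNReal.ofReal_le_ofReal
      have := hyF.2.2
      have : ψ y ≤ b0 + (j + 1) * δ := this
      gcongr
    have hE : ∀ j ∈ Finset.range N,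
        ENNReal.ofReal (C * Real.exp ((b0 + (j + 1) * δ) / ε)) * μ ε (F j) ≤
          ENNReal.ofReal (C * Real.exp ((b0 + 2 * δ) / ε)) := by
      intro j hj
      have h4 := h2 j hj
      rw [aux_log_lt hε] at h4
      refine (mul_le_mul_right h4.le _).trans ?_
      rw [← ENNReal.ofReal_mul (by positivity), mul_assoc, ← Real.exp_add, ← add_div]
      apply le_of_eq
      congr 4
      ring
    calc ∫⁻ y, ENNReal.ofReal (φ y * Real.exp (ψ y / ε)) ∂(μ ε)
        ≤ _ := lintegral_mono hpt
      _ = ENNReal.ofReal (C * Real.exp (b0 / ε)) + ∑ j ∈ Finset.range N,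
          ENNReal.ofReal (C * Real.exp ((b0 + (j + 1) * δ) / ε)) * μ ε (F j) := by
        rw [lintegral_add_left measurable_const, lintegral_const, measure_univ, mul_one,
          lintegral_finsetSum _ fun j _ => measurable_const.indicator (hF j).measurableSet]
        congr 1
        exact Finset.sum_congr rfl fun j _ => lintegral_indicator_const (hF j).measurableSet _
      _ ≤ ENNReal.ofReal (C * Real.exp ((b0 + 2 * δ) / ε)) + ∑ j ∈ Finset.range N,
          ENNReal.ofReal (C * Real.exp ((b0 + 2 * δ) / ε)) := by
        refine add_le_add (ENNReal.ofReal_le_ofReal ?_) (Finset.sum_le_sum hE)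
        gcongr
        linarith
      _ = ENNReal.ofReal (C * (N + 1) * Real.exp ((b0 + 2 * δ) / ε)) := by
        rw [Finset.sum_const, Finset.card_range, ← ENNReal.ofReal_nsmul,
          ← ENNReal.ofReal_add (by positivity) (by positivity)]
        congr 1
        rw [nsmul_eq_mul]
        ring
      _ < ENNReal.ofReal (Real.exp (b1 / ε)) := by
        refine (ENNReal.ofReal_lt_ofReal_iff (Real.exp_pos _)).2 ?_
        have : b1 / ε = δ / ε + (b0 + 2 * δ) / ε := by
          rw [← add_div]
          congr 1
          rw [hδ]; ring
        rw [this, Real.exp_add]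
        gcongr
end

section
/- Let n ≥ 1, let a¹, a² be symmetric positive definite n×n real matrices, and let c¹, c² > 0 be real constants. For p ∈ [0,1] set B_p = p·a¹ + (1−p)·a², T_p = p·c¹ + (1−p)·c², and Q_p(x) = ⟨B_p⁻¹ x, x⟩ for x ∈ ℝⁿ. Define λ : (0,∞) × ℝⁿ → ℝ by λ(t,x) = sup_{p∈[0,1]} ( t·T_p − Q_p(x)/(2t) ). Then λ is a concave function on the convex set (0,∞) × ℝⁿ: for all θ ∈ [0,1], t₁, t₂ > 0 and x₁, x₂ ∈ ℝⁿ, λ(θt₁ + (1−θ)t₂, θx₁ + (1−θ)x₂) ≥ θ·λ(t₁, x₁) + (1−θ)·λ(t₂, x₂). -/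
open Matrix

/-- The convex combination `B_p = p·a¹ + (1−p)·a²` of the diffusion matrices. -/
noncomputable def Bp {n : ℕ} (a1 a2 : Matrix (Fin n) (Fin n) ℝ) (p : ℝ) :
    Matrix (Fin n) (Fin n) ℝ :=
  p • a1 + (1 - p) • a2

/-- The convex combination `T_p = p·c¹ + (1−p)·c²` of the reaction rates. -/
noncomputable def Tp (c1 c2 p : ℝ) : ℝ := p * c1 + (1 - p) * c2

/-- The quadratic form `Q_p(x) = ⟨B_p⁻¹ x, x⟩`. -/
noncomputable def Qp {n : ℕ} (a1 a2 : Matrix (Fin n) (Fin n) ℝ) (p : ℝ)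
    (x : Fin n → ℝ) : ℝ :=
  (Bp a1 a2 p)⁻¹.mulVec x ⬝ᵥ x

/-- `λ(t,x) = sup_{p ∈ [0,1]} ( t·T_p − Q_p(x)/(2t) )`, formula (gtmo) of the paper. -/
noncomputable def lam {n : ℕ} (a1 a2 : Matrix (Fin n) (Fin n) ℝ) (c1 c2 : ℝ)
    (t : ℝ) (x : Fin n → ℝ) : ℝ :=
  ⨆ p : Set.Icc (0 : ℝ) 1, (t * Tp c1 c2 p - Qp a1 a2 (p : ℝ) x / (2 * t))

lemma Bp_posDef {n : ℕ} {a1 a2 : Matrix (Fin n) (Fin n) ℝ} (ha1 : a1.PosDef) (ha2 : a2.PosDef)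
    {p : ℝ} (h0 : 0 ≤ p) (h1 : p ≤ 1) : (Bp a1 a2 p).PosDef := by
  unfold Bp
  rcases h0.eq_or_lt with h | h
  · subst h; simpa using ha2
  · exact (ha1.smul h).add_posSemidef (ha2.posSemidef.smul (by linarith))

lemma quad_le {n : ℕ} {B : Matrix (Fin n) (Fin n) ℝ} (hB : B.PosDef) {t : ℝ} (ht : 0 < t)
    (x y : Fin n → ℝ) :
    2 * (y ⬝ᵥ x) - t * (y ⬝ᵥ B.mulVec y) ≤ (B⁻¹.mulVec x ⬝ᵥ x) / t := by
  have hu : IsUnit B.det := (Matrix.isUnit_iff_isUnit_det B).1 hB.isUnit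
  obtain ⟨z, rfl⟩ : ∃ z, x = B.mulVec z := ⟨B⁻¹.mulVec x, by
    rw [Matrix.mulVec_mulVec, Matrix.mul_nonsing_inv _ hu, Matrix.one_mulVec]⟩
  rw [Matrix.mulVec_mulVec, Matrix.nonsing_inv_mul _ hu, Matrix.one_mulVec]
  have h := hB.posSemidef.dotProduct_mulVec_nonneg (t • y - z)
  have hs : z ⬝ᵥ B.mulVec y = y ⬝ᵥ B.mulVec z := by
    have hT : Bᵀ = B := by
      rw [← Matrix.conjTranspose_eq_transpose_of_trivial]; exact hB.isHermitian
    rw [Matrix.dotProduct_mulVec, ← Matrix.mulVec_transpose, hT, dotProduct_comm]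
  simp only [star_trivial, Matrix.mulVec_sub, Matrix.mulVec_smul, sub_dotProduct, dotProduct_sub,
    smul_dotProduct, dotProduct_smul, smul_eq_mul, hs] at h
  rw [le_div_iff₀ ht]
  nlinarith

lemma quad_eq {n : ℕ} {B : Matrix (Fin n) (Fin n) ℝ} (hB : B.PosDef) {t : ℝ} (ht : 0 < t)
    (x : Fin n → ℝ) : ∃ y : Fin n → ℝ,
    2 * (y ⬝ᵥ x) - t * (y ⬝ᵥ B.mulVec y) = (B⁻¹.mulVec x ⬝ᵥ x) / t := by
  have hu : IsUnit B.det := (Matrix.isUnit_iff_isUnit_det B).1 hB.isUnit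
  refine ⟨t⁻¹ • B⁻¹.mulVec x, ?_⟩
  simp only [Matrix.mulVec_smul, Matrix.mulVec_mulVec, Matrix.mul_nonsing_inv _ hu,
    Matrix.one_mulVec, smul_dotProduct, dotProduct_smul, smul_eq_mul]
  field_simp
  ring

lemma lam_bdd {n : ℕ} {a1 a2 : Matrix (Fin n) (Fin n) ℝ} (ha1 : a1.PosDef) (ha2 : a2.PosDef)
    {c1 c2 : ℝ} (hc1 : 0 < c1) (hc2 : 0 < c2) {t : ℝ} (ht : 0 < t) (x : Fin n → ℝ) :
    BddAbove (Set.range fun p : Set.Icc (0 : ℝ) 1 =>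
      (t * Tp c1 c2 p - Qp a1 a2 (p : ℝ) x / (2 * t))) := by
  refine ⟨t * (c1 + c2), ?_⟩
  rintro _ ⟨⟨p, h0, h1⟩, rfl⟩
  have h := quad_le (Bp_posDef ha1 ha2 h0 h1) (t := 2 * t) (by linarith) x 0
  simp only [zero_dotProduct, mul_zero, sub_zero] at h
  have hT : Tp c1 c2 p ≤ c1 + c2 := by unfold Tp; nlinarith
  have := mul_le_mul_of_nonneg_left hT ht.le
  simp only [Qp]
  linarith

/-- Joint concavity of `λ` on `(0,∞) × ℝⁿ`: for `θ ∈ [0,1]`,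
`λ(θt₁+(1−θ)t₂, θx₁+(1−θ)x₂) ≥ θλ(t₁,x₁) + (1−θ)λ(t₂,x₂)`. -/
theorem lam_concave
    (n : ℕ) (hn : 1 ≤ n) (a1 a2 : Matrix (Fin n) (Fin n) ℝ)
    (ha1 : a1.PosDef) (ha2 : a2.PosDef)
    (c1 c2 : ℝ) (hc1 : 0 < c1) (hc2 : 0 < c2) :
    ∀ θ : ℝ, θ ∈ Set.Icc (0 : ℝ) 1 → ∀ t1 t2 : ℝ, 0 < t1 → 0 < t2 →
      ∀ x1 x2 : Fin n → ℝ,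
      θ * lam a1 a2 c1 c2 t1 x1 + (1 - θ) * lam a1 a2 c1 c2 t2 x2 ≤
        lam a1 a2 c1 c2 (θ * t1 + (1 - θ) * t2) (θ • x1 + (1 - θ) • x2) := by
  rintro θ ⟨hθ0, hθ1⟩ t1 t2 ht1 ht2 x1 x2
  set t := θ * t1 + (1 - θ) * t2 with htdef
  have ht : 0 < t := by
    rcases hθ0.eq_or_lt with h | h
    · rw [htdef, ← h]; linarith
    · have := mul_pos h ht1
      have := mul_nonneg (sub_nonneg.2 hθ1) ht2.le
      linarith
  refine le_of_forall_pos_le_add fun ε hε => ?_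
  obtain ⟨⟨p1, hp1⟩, h1⟩ := exists_lt_of_lt_ciSup
    (show lam a1 a2 c1 c2 t1 x1 - ε < lam a1 a2 c1 c2 t1 x1 by linarith)
  obtain ⟨⟨p2, hp2⟩, h2⟩ := exists_lt_of_lt_ciSup
    (show lam a1 a2 c1 c2 t2 x2 - ε < lam a1 a2 c1 c2 t2 x2 by linarith)
  have hθ' : 0 ≤ 1 - θ := sub_nonneg.2 hθ1
  obtain ⟨p, hp⟩ : ∃ p, t * p = θ * t1 * p1 + (1 - θ) * t2 * p2 :=
    ⟨(θ * t1 * p1 + (1 - θ) * t2 * p2) / t, by field_simp⟩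
  have hm1 : 0 ≤ θ * t1 := mul_nonneg hθ0 ht1.le
  have hm2 : 0 ≤ (1 - θ) * t2 := mul_nonneg hθ' ht2.le
  have hp0 : 0 ≤ p := by
    have := mul_nonneg hm1 hp1.1
    have := mul_nonneg hm2 hp2.1
    exact nonneg_of_mul_nonneg_right (by linarith : 0 ≤ t * p) ht
  have hp1' : p ≤ 1 := by
    have := mul_le_mul_of_nonneg_left hp1.2 hm1
    have := mul_le_mul_of_nonneg_left hp2.2 hm2
    exact le_of_mul_le_mul_left (by linarith : t * p ≤ t * 1) ht
  have hle := le_ciSup (lam_bdd ha1 ha2 hc1 hc2 ht (θ • x1 + (1 - θ) • x2)) ⟨p, hp0, hp1'⟩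
  change _ ≤ lam a1 a2 c1 c2 t (θ • x1 + (1 - θ) • x2) at hle
  obtain ⟨y, hy⟩ := quad_eq (Bp_posDef ha1 ha2 hp0 hp1') ht (θ • x1 + (1 - θ) • x2)
  have q1 := mul_le_mul_of_nonneg_left (quad_le (Bp_posDef ha1 ha2 hp1.1 hp1.2) ht1 x1 y) hθ0
  have q2 := mul_le_mul_of_nonneg_left (quad_le (Bp_posDef ha1 ha2 hp2.1 hp2.2) ht2 x2 y) hθ'
  have g1 := mul_le_mul_of_nonneg_left h1.le hθ0
  have g2 := mul_le_mul_of_nonneg_left h2.le hθ'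
  have e : ∀ a b : ℝ, a / (2 * b) = a / b / 2 := fun a b => by rw [mul_comm, div_div]
  simp only [e, Qp] at hle g1 g2
  rw [← hy] at hle
  have hquad : t * (y ⬝ᵥ (Bp a1 a2 p).mulVec y) = θ * t1 * (y ⬝ᵥ (Bp a1 a2 p1).mulVec y)
      + (1 - θ) * t2 * (y ⬝ᵥ (Bp a1 a2 p2).mulVec y) := by
    simp only [Bp, Matrix.add_mulVec, Matrix.smul_mulVec, dotProduct_add, dotProduct_smul,
      smul_eq_mul]
    linear_combination (y ⬝ᵥ a1.mulVec y - y ⬝ᵥ a2.mulVec y) * hp + (y ⬝ᵥ a2.mulVec y) * htdef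
  have hT : t * Tp c1 c2 p = θ * t1 * Tp c1 c2 p1 + (1 - θ) * t2 * Tp c1 c2 p2 := by
    simp only [Tp]
    linear_combination (c1 - c2) * hp + c2 * htdef
  rw [hT, hquad] at hle
  simp only [dotProduct_add, dotProduct_smul, smul_eq_mul] at hle
  linarith
end

section
/- Let n ≥ 1, let a¹, a² be symmetric positive definite n×n real matrices, and let c¹, c² > 0 be real constants. For p ∈ [0,1] set B_p = p·a¹ + (1−p)·a², T_p = p·c¹ + (1−p)·c², and Q_p(x) = ⟨B_p⁻¹ x, x⟩ for x ∈ ℝⁿ. Define λ : (0,∞) × ℝⁿ → ℝ by λ(t,x) = sup_{p∈[0,1]} ( t·T_p − Q_p(x)/(2t) ). Then for every x ≠ 0, the unique t > 0 satisfying λ(t,x) = 0 equals min_{p∈[0,1]} √( Q_p(x) / (2·T_p) ), and this minimum over p ∈ [0,1] is attained. -/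
open Matrix

theorem aux_Bp_posDef {n : ℕ} {a1 a2 : Matrix (Fin n) (Fin n) ℝ}
    (ha1 : a1.PosDef) (ha2 : a2.PosDef) {p : ℝ} (hp : p ∈ Set.Icc (0 : ℝ) 1) :
    (Bp a1 a2 p).PosDef := by
  unfold Bp
  rcases hp.1.eq_or_lt with h | h
  · rw [← h]; simpa using ha2
  · exact (ha1.smul h).add_posSemidef (ha2.posSemidef.smul (sub_nonneg.2 hp.2))

theorem aux_Tp_pos {c1 c2 : ℝ} (hc1 : 0 < c1) (hc2 : 0 < c2) {p : ℝ}
    (hp : p ∈ Set.Icc (0 : ℝ) 1) : 0 < Tp c1 c2 p := by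
  unfold Tp
  rcases hp.1.eq_or_lt with h | h
  · rw [← h]; simpa using hc2
  · have := mul_pos h hc1
    have := mul_nonneg (sub_nonneg.2 hp.2) hc2.le
    linarith

theorem aux_Qp_pos {n : ℕ} {a1 a2 : Matrix (Fin n) (Fin n) ℝ}
    (ha1 : a1.PosDef) (ha2 : a2.PosDef) {p : ℝ} (hp : p ∈ Set.Icc (0 : ℝ) 1)
    {x : Fin n → ℝ} (hx : x ≠ 0) : 0 < Qp a1 a2 p x := by
  have h := (aux_Bp_posDef ha1 ha2 hp).inv.dotProduct_mulVec_pos hx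
  unfold Qp
  rw [dotProduct_comm]
  simpa using h

theorem aux_Qp_cont {n : ℕ} {a1 a2 : Matrix (Fin n) (Fin n) ℝ}
    (ha1 : a1.PosDef) (ha2 : a2.PosDef) (x : Fin n → ℝ) :
    ContinuousOn (fun p => Qp a1 a2 p x) (Set.Icc (0 : ℝ) 1) := by
  have hB : Continuous (fun p => Bp a1 a2 p) := by unfold Bp; fun_prop
  have h1 : ContinuousOn (fun p => (Bp a1 a2 p)⁻¹) (Set.Icc (0 : ℝ) 1) := by
    simp only [Matrix.inv_def, Ring.inverse_eq_inv']
    have hd : ContinuousOn (fun p => (Bp a1 a2 p).det⁻¹) (Set.Icc (0 : ℝ) 1) :=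
      ContinuousOn.inv₀ hB.matrix_det.continuousOn
        (fun p hp => (aux_Bp_posDef ha1 ha2 hp).det_pos.ne')
    exact hd.smul hB.matrix_adjugate.continuousOn
  unfold Qp
  have h2 : Continuous (fun M : Matrix (Fin n) (Fin n) ℝ => M.mulVec x ⬝ᵥ x) :=
    (continuous_id.matrix_mulVec continuous_const).dotProduct continuous_const
  exact h2.comp_continuousOn h1

/-- For `x ≠ 0`, the unique `t > 0` with `λ(t,x) = 0` equals
`min_{p∈[0,1]} √(Q_p(x)/(2T_p))`, and this minimum is attained. -/
theorem lam_zero_eq_min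
    (n : ℕ) (hn : 1 ≤ n) (a1 a2 : Matrix (Fin n) (Fin n) ℝ)
    (ha1 : a1.PosDef) (ha2 : a2.PosDef)
    (c1 c2 : ℝ) (hc1 : 0 < c1) (hc2 : 0 < c2) :
    ∀ x : Fin n → ℝ, x ≠ 0 → ∃ m : ℝ,
      IsLeast {r : ℝ | ∃ p ∈ Set.Icc (0 : ℝ) 1,
        r = Real.sqrt (Qp a1 a2 p x / (2 * Tp c1 c2 p))} m ∧
      0 < m ∧ lam a1 a2 c1 c2 m x = 0 ∧
      ∀ t : ℝ, 0 < t → lam a1 a2 c1 c2 t x = 0 → t = m := by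
  intro x hx
  have hT : Continuous (fun p => Tp c1 c2 p) := by unfold Tp; fun_prop
  have hQ := aux_Qp_cont ha1 ha2 x
  have hne : (Set.Icc (0 : ℝ) 1).Nonempty := ⟨0, by simp⟩
  have hf : ContinuousOn (fun p => Qp a1 a2 p x / (2 * Tp c1 c2 p)) (Set.Icc (0 : ℝ) 1) :=
    hQ.div (by fun_prop) (fun p hp => by have := aux_Tp_pos hc1 hc2 hp; positivity)
  obtain ⟨p0, hp0, hmin⟩ := isCompact_Icc.exists_isMinOn hne hf
  have hfpos : 0 < Qp a1 a2 p0 x / (2 * Tp c1 c2 p0) :=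
    div_pos (aux_Qp_pos ha1 ha2 hp0 hx) (by have := aux_Tp_pos hc1 hc2 hp0; positivity)
  have key : ∀ t : ℝ, 0 < t → ∀ p ∈ Set.Icc (0 : ℝ) 1,
      t * Tp c1 c2 p - Qp a1 a2 p x / (2 * t)
        = (t ^ 2 - Qp a1 a2 p x / (2 * Tp c1 c2 p)) * (Tp c1 c2 p / t) := by
    intro t ht p hp
    have := aux_Tp_pos hc1 hc2 hp
    field_simp
  -- the supremum is attained
  have hsup : ∀ t : ℝ, 0 < t → ∃ p1 ∈ Set.Icc (0 : ℝ) 1,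
      lam a1 a2 c1 c2 t x = t * Tp c1 c2 p1 - Qp a1 a2 p1 x / (2 * t) ∧
      ∀ p ∈ Set.Icc (0 : ℝ) 1, t * Tp c1 c2 p - Qp a1 a2 p x / (2 * t) ≤
        lam a1 a2 c1 c2 t x := by
    intro t ht
    have hg : ContinuousOn (fun p => t * Tp c1 c2 p - Qp a1 a2 p x / (2 * t))
        (Set.Icc (0 : ℝ) 1) :=
      (ContinuousOn.mul continuousOn_const hT.continuousOn).sub (hQ.div_const _)
    obtain ⟨p1, hp1, hmax⟩ := isCompact_Icc.exists_isMaxOn hne hg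
    have hmax' : ∀ p ∈ Set.Icc (0 : ℝ) 1, t * Tp c1 c2 p - Qp a1 a2 p x / (2 * t) ≤
        t * Tp c1 c2 p1 - Qp a1 a2 p1 x / (2 * t) := fun p hp => hmax hp
    have heq : lam a1 a2 c1 c2 t x = t * Tp c1 c2 p1 - Qp a1 a2 p1 x / (2 * t) := by
      unfold lam
      haveI : Nonempty (Set.Icc (0 : ℝ) 1) := ⟨⟨p1, hp1⟩⟩
      apply le_antisymm
      · exact ciSup_le fun p => hmax' p p.2
      · exact le_ciSup (f := fun p : Set.Icc (0 : ℝ) 1 =>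
          t * Tp c1 c2 p - Qp a1 a2 (p : ℝ) x / (2 * t))
          ⟨_, by rintro _ ⟨p, rfl⟩; exact hmax' p p.2⟩ ⟨p1, hp1⟩
    exact ⟨p1, hp1, heq, fun p hp => heq ▸ hmax' p hp⟩
  have hmin' : ∀ p ∈ Set.Icc (0 : ℝ) 1, Qp a1 a2 p0 x / (2 * Tp c1 c2 p0) ≤
      Qp a1 a2 p x / (2 * Tp c1 c2 p) := fun p hp => hmin hp
  -- zero characterises the square
  have hzero : ∀ t : ℝ, 0 < t →
      (lam a1 a2 c1 c2 t x = 0 ↔ t ^ 2 = Qp a1 a2 p0 x / (2 * Tp c1 c2 p0)) := by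
    intro t ht
    obtain ⟨p1, hp1, heq, hle⟩ := hsup t ht
    have h0 := hle p0 hp0
    rw [key t ht p0 hp0] at h0
    rw [key t ht p1 hp1] at heq
    have hr0 : 0 < Tp c1 c2 p0 / t := div_pos (aux_Tp_pos hc1 hc2 hp0) ht
    have hr1 : 0 < Tp c1 c2 p1 / t := div_pos (aux_Tp_pos hc1 hc2 hp1) ht
    have hm1 := hmin' p1 hp1
    constructor
    · intro hl
      rw [hl] at heq h0
      have e1 := (mul_eq_zero.1 heq.symm).resolve_right hr1.ne'
      have e0 := nonpos_of_mul_nonpos_left h0 hr0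
      linarith
    · intro hl
      apply le_antisymm
      · rw [heq]
        exact mul_nonpos_of_nonpos_of_nonneg (by linarith) hr1.le
      · rw [hl, sub_self, zero_mul] at h0
        exact h0
  refine ⟨Real.sqrt (Qp a1 a2 p0 x / (2 * Tp c1 c2 p0)), ⟨⟨p0, hp0, rfl⟩, ?_⟩,
    Real.sqrt_pos.2 hfpos, ?_, ?_⟩
  · rintro _ ⟨p, hp, rfl⟩
    exact Real.sqrt_le_sqrt (hmin' p hp)
  · exact (hzero _ (Real.sqrt_pos.2 hfpos)).2 (Real.sq_sqrt hfpos.le)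
  · intro t ht hl
    rw [← (hzero t ht).1 hl, Real.sqrt_sq ht.le]
end
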